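/- Let A, B, C, D be jointly distributed discrete random variables taking finitely many values in a field (or a ring with no zero divisors), none of which ever takes the value 0. Then H(AB + CD) + H(AB, CD, A(B−D), (A+C)D) ≤ H(AB, CD) + H(A(B−D), (A+C)D). If A, B, C, D are i.i.d., then H(AB + CD) ≤ 5 H(AB) + H(A + B) + H(A − B) − 6 H(A), and consequently H(AB + CD) ≤ 5 H(AB) + 3 H(A + B) − 7 H(A). -/

import Mathlib

/-- The probability of the event `E` under the probability mass function `p`
on a finite sample space. -/
noncomputable def prob {Ω : Type*} [Fintype Ω] (p : Ω → ℝ) (E : Set Ω) : ℝ :=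
  ∑ ω, E.indicator p ω

/-- The Shannon entropy (base 2) of the discrete random variable `X` on the finite
probability space given by the probability mass function `p`. -/
noncomputable def ent {Ω S : Type*} [Fintype Ω] (p : Ω → ℝ) (X : Ω → S) : ℝ :=
  letI := Classical.decEq S
  ∑ v ∈ Finset.univ.image X,
      -(prob p {ω | X ω = v} * Real.logb 2 (prob p {ω | X ω = v}))

open Classical in
lemma prob_eq_sum {Ω : Type*} [Fintype Ω] (p : Ω → ℝ) (P : Ω → Prop) :
    prob p {ω | P ω} = ∑ ω, if P ω then p ω else 0 := by
  unfold prob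
  refine Finset.sum_congr rfl fun ω _ => ?_
  simp [Set.indicator_apply]

lemma prob_nonneg' {Ω : Type*} [Fintype Ω] (p : Ω → ℝ) (hp : ∀ ω, 0 ≤ p ω) (P : Ω → Prop) :
    0 ≤ prob p {ω | P ω} :=
  Finset.sum_nonneg fun ω _ => Set.indicator_nonneg (fun ω _ => hp ω) ω

lemma prob_mono' {Ω : Type*} [Fintype Ω] (p : Ω → ℝ) (hp : ∀ ω, 0 ≤ p ω) (P Q : Ω → Prop)
    (h : ∀ ω, p ω ≠ 0 → P ω → Q ω) : prob p {ω | P ω} ≤ prob p {ω | Q ω} := by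
  classical
  rw [prob_eq_sum, prob_eq_sum]
  refine Finset.sum_le_sum fun ω _ => ?_
  by_cases h0 : p ω = 0
  · simp [h0]
  · by_cases h1 : P ω
    · simp [h1, h ω h0 h1]
    · simp only [h1, if_false]
      split_ifs
      · exact hp ω
      · exact le_rfl

lemma prob_le_one' {Ω : Type*} [Fintype Ω] (p : Ω → ℝ) (hp : ∀ ω, 0 ≤ p ω)
    (hp1 : ∑ ω, p ω = 1) (P : Ω → Prop) : prob p {ω | P ω} ≤ 1 := by
  classical
  rw [← hp1, prob_eq_sum]
  refine Finset.sum_le_sum fun ω _ => ?_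
  split_ifs
  · exact le_rfl
  · exact hp ω

lemma prob_pos' {Ω : Type*} [Fintype Ω] (p : Ω → ℝ) (hp : ∀ ω, 0 ≤ p ω) (P : Ω → Prop)
    (ω : Ω) (h0 : p ω ≠ 0) (h : P ω) : 0 < prob p {ω | P ω} := by
  classical
  rw [prob_eq_sum]
  refine Finset.sum_pos' (fun ω _ => ?_) ⟨ω, Finset.mem_univ _, ?_⟩
  · split_ifs
    · exact hp ω
    · exact le_rfl
  · simp only [h, if_true]
    exact lt_of_le_of_ne (hp ω) (Ne.symm h0)

open Classical in
lemma ent_eq_superset {Ω S : Type*} [Fintype Ω] (p : Ω → ℝ) (X : Ω → S) (T : Finset S)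
    (hT : ∀ ω, X ω ∈ T) :
    ent p X = ∑ v ∈ T, -(prob p {ω | X ω = v} * Real.logb 2 (prob p {ω | X ω = v})) := by
  unfold ent
  refine Finset.sum_subset_zero_on_sdiff ?_ ?_ ?_
  · intro v hv
    obtain ⟨ω, -, rfl⟩ := Finset.mem_image.1 hv
    exact hT ω
  · intro v hv
    have : prob p {ω | X ω = v} = 0 := by
      rw [prob_eq_sum]
      refine Finset.sum_eq_zero fun ω _ => ?_
      rw [if_neg]
      rintro rfl
      exact (Finset.mem_sdiff.1 hv).2 (Finset.mem_image_of_mem _ (Finset.mem_univ _))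
    simp [this]
  · intro v _
    rfl

lemma ent_eq_sum {Ω S : Type*} [Fintype Ω] (p : Ω → ℝ) (X : Ω → S) :
    ent p X = ∑ ω, -(p ω * Real.logb 2 (prob p {ω' | X ω' = X ω})) := by
  classical
  rw [ent_eq_superset p X (Finset.univ.image X)
    (fun ω => Finset.mem_image_of_mem _ (Finset.mem_univ _))]
  rw [← Finset.sum_fiberwise_of_maps_to (s := Finset.univ) (t := Finset.univ.image X) (g := X)
    (fun ω _ => Finset.mem_image_of_mem _ (Finset.mem_univ _))]
  refine Finset.sum_congr rfl fun v _ => ?_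
  rw [Finset.sum_congr rfl (g := fun ω => -(p ω * Real.logb 2 (prob p {ω' | X ω' = v})))]
  · rw [Finset.sum_neg_distrib, ← Finset.sum_mul]
    congr 2
    rw [prob_eq_sum, Finset.sum_filter]
  · intro ω hω
    rw [(Finset.mem_filter.1 hω).2]

/-- `Z` is determined by `X` on the support of `p`. -/
def Det {Ω S T : Type*} (p : Ω → ℝ) (X : Ω → S) (Z : Ω → T) : Prop :=
  ∀ ω ω', p ω ≠ 0 → p ω' ≠ 0 → X ω = X ω' → Z ω = Z ω'

lemma ent_mono {Ω S T : Type*} [Fintype Ω] (p : Ω → ℝ) (hp : ∀ ω, 0 ≤ p ω)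
    (X : Ω → S) (Z : Ω → T) (h : Det p X Z) : ent p Z ≤ ent p X := by
  rw [ent_eq_sum, ent_eq_sum]
  refine Finset.sum_le_sum fun ω _ => ?_
  by_cases h0 : p ω = 0
  · simp [h0]
  · refine neg_le_neg (mul_le_mul_of_nonneg_left ?_ (hp ω))
    refine Real.logb_le_logb_of_le (by norm_num) (prob_pos' p hp _ ω h0 rfl) ?_
    exact prob_mono' p hp _ _ fun ω' h' e => h ω' ω h' h0 e

lemma ent_nonneg' {Ω S : Type*} [Fintype Ω] (p : Ω → ℝ) (hp : ∀ ω, 0 ≤ p ω)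
    (hp1 : ∑ ω, p ω = 1) (X : Ω → S) : 0 ≤ ent p X := by
  rw [ent_eq_sum]
  refine Finset.sum_nonneg fun ω _ => ?_
  by_cases h0 : p ω = 0
  · simp [h0]
  · have := Real.logb_nonpos (b := 2) (by norm_num) (prob_nonneg' p hp (fun ω' => X ω' = X ω))
      (prob_le_one' p hp hp1 _)
    have := mul_nonneg (hp ω) (neg_nonneg.2 this)
    linarith

lemma submod_aux {Ω S T U : Type*} [Fintype Ω] (p : Ω → ℝ) (hp : ∀ ω, 0 ≤ p ω)
    (hp1 : ∑ ω, p ω = 1) (X : Ω → S) (Y : Ω → T) (Z : Ω → U) (hX : Det p X Z) (hY : Det p Y Z) :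
    ∑ ω, p ω * (prob p {ω' | X ω' = X ω} * prob p {ω' | Y ω' = Y ω} /
      (prob p {ω' | Z ω' = Z ω} * prob p {ω' | (X ω', Y ω') = (X ω, Y ω)})) ≤ 1 := by
  classical
  set qZ : Ω → ℝ := fun ω => prob p {ω' | Z ω' = Z ω} with hqZ
  set qW : Ω → ℝ := fun ω => prob p {ω' | (X ω', Y ω') = (X ω, Y ω)} with hqW
  have hqZ0 : ∀ ω, 0 ≤ qZ ω := fun ω => prob_nonneg' p hp _
  have hqW0 : ∀ ω, 0 ≤ qW ω := fun ω => prob_nonneg' p hp _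
  have e1 : ∑ ω, p ω * (prob p {ω' | X ω' = X ω} * prob p {ω' | Y ω' = Y ω} / (qZ ω * qW ω)) =
      ∑ a, ∑ b, ∑ ω, p ω * (((if X a = X ω then p a else 0) * (if Y b = Y ω then p b else 0)) /
        (qZ ω * qW ω)) := by
    simp_rw [prob_eq_sum p, Finset.sum_mul_sum, Finset.sum_div, Finset.mul_sum]
    rw [Finset.sum_comm]
    refine Finset.sum_congr rfl fun a _ => ?_
    rw [Finset.sum_comm]
  have e2 : ∀ a b, ∑ ω, p ω * (((if X a = X ω then p a else 0) *
      (if Y b = Y ω then p b else 0)) / (qZ ω * qW ω)) ≤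
      p a * ((if Z b = Z a then p b else 0) / qZ a) := by
    intro a b
    have hR : 0 ≤ p a * ((if Z b = Z a then p b else 0) / qZ a) := by
      refine mul_nonneg (hp a) (div_nonneg ?_ (hqZ0 a))
      split_ifs
      · exact hp b
      · exact le_rfl
    by_cases hex : p a ≠ 0 ∧ p b ≠ 0 ∧ ∃ ω, p ω ≠ 0 ∧ X a = X ω ∧ Y b = Y ω
    · obtain ⟨ha, hb, ω0, h0, hx, hy⟩ := hex
      have hza : Z a = Z ω0 := hX _ _ ha h0 hx
      have hzb : Z b = Z ω0 := hY _ _ hb h0 hy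
      have hWpos : 0 < qW ω0 := prob_pos' p hp _ ω0 h0 rfl
      have : ∀ ω, p ω * (((if X a = X ω then p a else 0) *
          (if Y b = Y ω then p b else 0)) / (qZ ω * qW ω)) =
          (if (X ω, Y ω) = (X ω0, Y ω0) then p ω else 0) * (p a * p b / (qZ a * qW ω0)) := by
        intro ω
        by_cases hw : p ω = 0
        · simp [hw]
        by_cases h1 : X a = X ω
        · by_cases h2 : Y b = Y ω
          · have hz : Z a = Z ω := hX _ _ ha hw h1
            have hc : (X ω, Y ω) = (X ω0, Y ω0) := by rw [← h1, ← h2, hx, hy]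
            simp only [h1, h2, if_true, hc]
            simp only [hqZ, hqW, hz, hc]
          · have : ¬ (X ω, Y ω) = (X ω0, Y ω0) := by
              intro h
              exact h2 (hy.trans (Prod.ext_iff.1 h).2.symm)
            rw [if_neg this, if_neg h2]
            simp
        · have : ¬ (X ω, Y ω) = (X ω0, Y ω0) := by
            intro h
            exact h1 (hx.trans (Prod.ext_iff.1 h).1.symm)
          rw [if_neg this, if_neg h1]
          simp
      rw [Finset.sum_congr rfl fun ω _ => this ω, ← Finset.sum_mul]
      have hs : (∑ ω, if (X ω, Y ω) = (X ω0, Y ω0) then p ω else 0) = qW ω0 := by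
        simp only [hqW]
        rw [prob_eq_sum]
        refine Finset.sum_congr rfl fun ω _ => ?_
        congr
      rw [hs]
      rw [if_pos (hzb.trans hza.symm)]
      have hZpos : 0 < qZ a := prob_pos' p hp _ a ha rfl
      apply le_of_eq
      field_simp
    · refine le_trans (le_of_eq (Finset.sum_eq_zero fun ω _ => ?_)) hR
      by_contra hne
      apply hex
      refine ⟨?_, ?_, ω, ?_, ?_, ?_⟩
      · intro h; simp [h] at hne
      · intro h; simp [h] at hne
      · intro h; simp [h] at hne
      · by_contra h; simp [h] at hne
      · by_contra h; simp [h] at hne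
  rw [e1]
  calc _ ≤ ∑ a, ∑ b, p a * ((if Z b = Z a then p b else 0) / qZ a) :=
        Finset.sum_le_sum fun a _ => Finset.sum_le_sum fun b _ => e2 a b
    _ = ∑ a, p a := by
        refine Finset.sum_congr rfl fun a _ => ?_
        rw [← Finset.mul_sum, ← Finset.sum_div, ← prob_eq_sum p (fun b => Z b = Z a)]
        change p a * (qZ a / qZ a) = _
        by_cases ha : p a = 0
        · simp [ha]
        · have hZpos : 0 < qZ a := prob_pos' p hp _ a ha rfl
          rw [div_self hZpos.ne', mul_one]
    _ = 1 := hp1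

/-- Submodularity of entropy. -/
lemma ent_submod {Ω S T U : Type*} [Fintype Ω] (p : Ω → ℝ) (hp : ∀ ω, 0 ≤ p ω)
    (hp1 : ∑ ω, p ω = 1) (X : Ω → S) (Y : Ω → T) (Z : Ω → U) (hX : Det p X Z) (hY : Det p Y Z) :
    ent p Z + ent p (fun ω => (X ω, Y ω)) ≤ ent p X + ent p Y := by
  have key := submod_aux p hp hp1 X Y Z hX hY
  rw [ent_eq_sum, ent_eq_sum, ent_eq_sum, ent_eq_sum, ← sub_nonpos]
  rw [← Finset.sum_add_distrib, ← Finset.sum_add_distrib, ← Finset.sum_sub_distrib]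
  have hl : 0 < Real.log 2 := Real.log_pos (by norm_num)
  refine le_trans (b := ∑ ω, (p ω * (prob p {ω' | X ω' = X ω} * prob p {ω' | Y ω' = Y ω} /
      (prob p {ω' | Z ω' = Z ω} * prob p {ω' | (X ω', Y ω') = (X ω, Y ω)})) - p ω) / Real.log 2)
    (Finset.sum_le_sum fun ω _ => ?_) ?_
  · by_cases h0 : p ω = 0
    · simp [h0]
    have x := prob_pos' p hp (fun ω' => X ω' = X ω) ω h0 rfl
    have y := prob_pos' p hp (fun ω' => Y ω' = Y ω) ω h0 rfl
    have z := prob_pos' p hp (fun ω' => Z ω' = Z ω) ω h0 rfl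
    have w := prob_pos' p hp (fun ω' => (X ω', Y ω') = (X ω, Y ω)) ω h0 rfl
    have := Real.log_le_sub_one_of_pos (div_pos (mul_pos x y) (mul_pos z w))
    rw [Real.log_div (mul_pos x y).ne' (mul_pos z w).ne', Real.log_mul x.ne' y.ne',
      Real.log_mul z.ne' w.ne'] at this
    have := mul_le_mul_of_nonneg_left this (hp ω)
    rw [le_div_iff₀ hl]
    simp only [Real.logb]
    field_simp
    field_simp at this
    linarith
  · rw [← Finset.sum_div, Finset.sum_sub_distrib, hp1]
    exact div_nonpos_of_nonpos_of_nonneg (by linarith) hl.le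

lemma ent_subadd {Ω S T : Type*} [Fintype Ω] (p : Ω → ℝ) (hp : ∀ ω, 0 ≤ p ω)
    (hp1 : ∑ ω, p ω = 1) (X : Ω → S) (Y : Ω → T) :
    ent p (fun ω => (X ω, Y ω)) ≤ ent p X + ent p Y := by
  have := ent_submod p hp hp1 X Y (fun _ => ()) (fun _ _ _ _ _ => rfl) (fun _ _ _ _ _ => rfl)
  have := ent_nonneg' p hp hp1 (fun _ : Ω => ())
  linarith

/-- Convenient form of submodularity. -/
lemma ent_submod' {Ω S T U V : Type*} [Fintype Ω] (p : Ω → ℝ) (hp : ∀ ω, 0 ≤ p ω)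
    (hp1 : ∑ ω, p ω = 1) (X : Ω → S) (Y : Ω → T) (Z : Ω → U) (W : Ω → V)
    (hX : Det p X Z) (hY : Det p Y Z) (hW : Det p (fun ω => (X ω, Y ω)) W) :
    ent p Z + ent p W ≤ ent p X + ent p Y := by
  have h1 := ent_submod p hp hp1 X Y Z hX hY
  have h2 := ent_mono p hp _ W hW
  linarith

/-- Entropy of a function only depends on the law. -/
lemma ent_law {Ω S T : Type*} [Fintype Ω] (p : Ω → ℝ) (X X' : Ω → S)
    (h : ∀ s, prob p {ω | X ω = s} = prob p {ω | X' ω = s}) (f : S → T) :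
    ent p (fun ω => f (X ω)) = ent p (fun ω => f (X' ω)) := by
  classical
  set I : Finset S := Finset.univ.image X ∪ Finset.univ.image X' with hI
  have hX : ∀ ω, X ω ∈ I := fun ω =>
    Finset.mem_union_left _ (Finset.mem_image_of_mem _ (Finset.mem_univ _))
  have hX' : ∀ ω, X' ω ∈ I := fun ω =>
    Finset.mem_union_right _ (Finset.mem_image_of_mem _ (Finset.mem_univ _))
  have key : ∀ (Y : Ω → S), (∀ ω, Y ω ∈ I) → ∀ v, prob p {ω | f (Y ω) = v} =
      ∑ s ∈ I, if f s = v then prob p {ω | Y ω = s} else 0 := by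
    intro Y hY v
    simp_rw [prob_eq_sum p, ← Finset.sum_filter (s := I)]
    rw [Finset.sum_comm]
    refine Finset.sum_congr rfl fun ω _ => ?_
    rw [Finset.sum_ite_eq]
    simp [hY ω]
  rw [ent_eq_superset p _ (I.image f) (fun ω => Finset.mem_image_of_mem f (hX ω)),
    ent_eq_superset p _ (I.image f) (fun ω => Finset.mem_image_of_mem f (hX' ω))]
  refine Finset.sum_congr rfl fun v _ => ?_
  rw [key X hX, key X' hX']
  simp_rw [h]

lemma ent_indep4 {Ω R : Type*} [Fintype Ω] (p : Ω → ℝ) (hp : ∀ ω, 0 ≤ p ω)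
    (A B C D : Ω → R)
    (h : ∀ a b c d : R, prob p {ω | A ω = a ∧ B ω = b ∧ C ω = c ∧ D ω = d} =
        prob p {ω | A ω = a} * prob p {ω | B ω = b} * prob p {ω | C ω = c} *
          prob p {ω | D ω = d}) :
    ent p (fun ω => (A ω, B ω, C ω, D ω)) = ent p A + ent p B + ent p C + ent p D := by
  simp_rw [ent_eq_sum p, ← Finset.sum_add_distrib]
  refine Finset.sum_congr rfl fun ω _ => ?_
  by_cases h0 : p ω = 0
  · simp [h0]
  have a := prob_pos' p hp (fun ω' => A ω' = A ω) ω h0 rfl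
  have b := prob_pos' p hp (fun ω' => B ω' = B ω) ω h0 rfl
  have c := prob_pos' p hp (fun ω' => C ω' = C ω) ω h0 rfl
  have d := prob_pos' p hp (fun ω' => D ω' = D ω) ω h0 rfl
  simp only [Prod.mk.injEq]
  rw [h, Real.logb_mul (by positivity) d.ne', Real.logb_mul (by positivity) c.ne',
    Real.logb_mul a.ne' b.ne']
  ring

lemma ne_zero_of_prob {Ω R : Type*} [Fintype Ω] [Zero R] (p : Ω → ℝ) (hp : ∀ ω, 0 ≤ p ω)
    (A : Ω → R) (hA : prob p {ω | A ω = 0} = 0) (ω : Ω) (h : p ω ≠ 0) : A ω ≠ 0 := fun h0 =>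
  (prob_pos' p hp (fun ω => A ω = 0) ω h h0).ne' hA

theorem ring_plunnecke_ruzsa_add {Ω R : Type*} [Fintype Ω] [CommRing R] [NoZeroDivisors R]
    (p : Ω → ℝ) (hp : ∀ ω, 0 ≤ p ω) (hp1 : ∑ ω, p ω = 1) (A B C D : Ω → R)
    (hA0 : prob p {ω | A ω = 0} = 0) (hB0 : prob p {ω | B ω = 0} = 0)
    (hC0 : prob p {ω | C ω = 0} = 0) (hD0 : prob p {ω | D ω = 0} = 0) :
    (ent p (fun ω => A ω * B ω + C ω * D ω) +
        ent p (fun ω => (A ω * B ω, C ω * D ω, A ω * (B ω - D ω), (A ω + C ω) * D ω)) ≤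
      ent p (fun ω => (A ω * B ω, C ω * D ω)) +
        ent p (fun ω => (A ω * (B ω - D ω), (A ω + C ω) * D ω))) ∧
    ((∀ a b c d : R, prob p {ω | A ω = a ∧ B ω = b ∧ C ω = c ∧ D ω = d} =
        prob p {ω | A ω = a} * prob p {ω | B ω = b} * prob p {ω | C ω = c} *
          prob p {ω | D ω = d}) →
      (∀ r : R, prob p {ω | B ω = r} = prob p {ω | A ω = r}) →
      (∀ r : R, prob p {ω | C ω = r} = prob p {ω | A ω = r}) →
      (∀ r : R, prob p {ω | D ω = r} = prob p {ω | A ω = r}) →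
      ent p (fun ω => A ω * B ω + C ω * D ω) ≤
          5 * ent p (fun ω => A ω * B ω) + ent p (fun ω => A ω + B ω) +
            ent p (fun ω => A ω - B ω) - 6 * ent p A ∧
      ent p (fun ω => A ω * B ω + C ω * D ω) ≤
          5 * ent p (fun ω => A ω * B ω) + 3 * ent p (fun ω => A ω + B ω) - 7 * ent p A) := by
  have nA := ne_zero_of_prob p hp A hA0
  have nD := ne_zero_of_prob p hp D hD0
  have part1 : ent p (fun ω => A ω * B ω + C ω * D ω) +
        ent p (fun ω => (A ω * B ω, C ω * D ω, A ω * (B ω - D ω), (A ω + C ω) * D ω)) ≤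
      ent p (fun ω => (A ω * B ω, C ω * D ω)) +
        ent p (fun ω => (A ω * (B ω - D ω), (A ω + C ω) * D ω)) := by
    apply ent_submod' p hp hp1
    · intro ω ω' _ _ h
      simp only [Prod.mk.injEq] at h
      simp only [h.1, h.2]
    · intro ω ω' _ _ h
      simp only [Prod.mk.injEq] at h
      linear_combination h.1 + h.2
    · intro ω ω' _ _ h
      simp only [Prod.mk.injEq] at h ⊢
      tauto
  refine ⟨part1, fun hind hB hC hD => ?_⟩
  have EB : ent p B = ent p A := ent_law p B A hB id
  have EC : ent p C = ent p A := ent_law p C A hC id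
  have ED : ent p D = ent p A := ent_law p D A hD id
  have E4 := ent_indep4 p hp A B C D hind
  have perm1 : ∀ s : R × R × R × R, prob p {ω | (A ω, D ω, C ω, B ω) = s} =
      prob p {ω | (A ω, B ω, C ω, D ω) = s} := by
    rintro ⟨a, b, c, d⟩
    simp only [Prod.mk.injEq]
    rw [hind, show {ω | A ω = a ∧ D ω = b ∧ C ω = c ∧ B ω = d} =
      {ω | A ω = a ∧ B ω = d ∧ C ω = c ∧ D ω = b} by ext; simp; tauto, hind]
    simp only [hB, hC, hD]; ring
  have perm2 : ∀ s : R × R × R × R, prob p {ω | (C ω, D ω, A ω, B ω) = s} =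
      prob p {ω | (A ω, B ω, C ω, D ω) = s} := by
    rintro ⟨a, b, c, d⟩
    simp only [Prod.mk.injEq]
    rw [hind, show {ω | C ω = a ∧ D ω = b ∧ A ω = c ∧ B ω = d} =
      {ω | A ω = c ∧ B ω = d ∧ C ω = a ∧ D ω = b} by ext; simp; tauto, hind]
    simp only [hB, hC, hD]; ring
  have perm3 : ∀ s : R × R × R × R, prob p {ω | (A ω, C ω, B ω, D ω) = s} =
      prob p {ω | (A ω, B ω, C ω, D ω) = s} := by
    rintro ⟨a, b, c, d⟩
    simp only [Prod.mk.injEq]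
    rw [hind, show {ω | A ω = a ∧ C ω = b ∧ B ω = c ∧ D ω = d} =
      {ω | A ω = a ∧ B ω = c ∧ C ω = b ∧ D ω = d} by ext; simp; tauto, hind]
    simp only [hB, hC, hD]; ring
  have perm4 : ∀ s : R × R × R × R, prob p {ω | (B ω, C ω, A ω, D ω) = s} =
      prob p {ω | (A ω, B ω, C ω, D ω) = s} := by
    rintro ⟨a, b, c, d⟩
    simp only [Prod.mk.injEq]
    rw [hind, show {ω | B ω = a ∧ C ω = b ∧ A ω = c ∧ D ω = d} =
      {ω | A ω = c ∧ B ω = a ∧ C ω = b ∧ D ω = d} by ext; simp; tauto, hind]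
    simp only [hB, hC, hD]; ring
  have perm5 : ∀ s : R × R × R × R, prob p {ω | (B ω, D ω, A ω, C ω) = s} =
      prob p {ω | (A ω, B ω, C ω, D ω) = s} := by
    rintro ⟨a, b, c, d⟩
    simp only [Prod.mk.injEq]
    rw [hind, show {ω | B ω = a ∧ D ω = b ∧ A ω = c ∧ C ω = d} =
      {ω | A ω = c ∧ B ω = a ∧ C ω = d ∧ D ω = b} by ext; simp; tauto, hind]
    simp only [hB, hC, hD]; ring
  have LAD : ent p (fun ω => A ω * D ω) = ent p (fun ω => A ω * B ω) :=
    ent_law p _ _ perm1 (fun s => s.1 * s.2.1)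
  have LCD : ent p (fun ω => C ω * D ω) = ent p (fun ω => A ω * B ω) :=
    ent_law p _ _ perm2 (fun s => s.1 * s.2.1)
  have LAC : ent p (fun ω => A ω + C ω) = ent p (fun ω => A ω + B ω) :=
    ent_law p _ _ perm3 (fun s => s.1 + s.2.1)
  have LBC : ent p (fun ω => B ω + C ω) = ent p (fun ω => A ω + B ω) :=
    ent_law p _ _ perm4 (fun s => s.1 + s.2.1)
  have LBD : ent p (fun ω => B ω - D ω) = ent p (fun ω => A ω - B ω) :=
    ent_law p _ _ perm5 (fun s => s.1 - s.2.1)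
  -- lower bounds for triples
  have TABD : ent p (fun ω => (A ω, B ω, C ω, D ω)) ≤ ent p (fun ω => (A ω, B ω, D ω)) + ent p C := by
    refine le_trans (ent_mono p hp _ _ ?_) (ent_subadd p hp hp1 _ C)
    intro ω ω' _ _ h
    simp only [Prod.mk.injEq] at h ⊢
    tauto
  have TACD : ent p (fun ω => (A ω, B ω, C ω, D ω)) ≤ ent p (fun ω => (A ω, C ω, D ω)) + ent p B := by
    refine le_trans (ent_mono p hp _ _ ?_) (ent_subadd p hp hp1 _ B)
    intro ω ω' _ _ h
    simp only [Prod.mk.injEq] at h ⊢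
    tauto
  have TABC : ent p (fun ω => (A ω, B ω, C ω, D ω)) ≤ ent p (fun ω => (A ω, B ω, C ω)) + ent p D := by
    refine le_trans (ent_mono p hp _ _ ?_) (ent_subadd p hp hp1 _ D)
    intro ω ω' _ _ h
    simp only [Prod.mk.injEq] at h ⊢
    tauto
  -- the difference term
  have S1 : ent p (fun ω => A ω * (B ω - D ω)) + ent p (fun ω => (A ω, B ω, D ω)) ≤
      ent p (fun ω => (A ω * B ω, A ω * D ω)) + ent p (fun ω => (A ω, B ω - D ω)) := by
    apply ent_submod' p hp hp1
    · intro ω ω' _ _ h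
      simp only [Prod.mk.injEq] at h
      linear_combination h.1 - h.2
    · intro ω ω' _ _ h
      simp only [Prod.mk.injEq] at h
      simp only [h.1, h.2]
    · intro ω ω' h0 h0' h
      simp only [Prod.mk.injEq] at h ⊢
      obtain ⟨⟨h1, h2⟩, h3, h4⟩ := h
      rw [h3] at h1 h2
      exact ⟨h3, mul_left_cancel₀ (nA ω' h0') h1, mul_left_cancel₀ (nA ω' h0') h2⟩
  have S1a := ent_subadd p hp hp1 (fun ω => A ω * B ω) (fun ω => A ω * D ω)
  have S1b := ent_subadd p hp hp1 A (fun ω => B ω - D ω)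
  -- the sum term
  have S2 : ent p (fun ω => (A ω + C ω) * D ω) + ent p (fun ω => (A ω, C ω, D ω)) ≤
      ent p (fun ω => (A ω * D ω, C ω * D ω)) + ent p (fun ω => (A ω + C ω, D ω)) := by
    apply ent_submod' p hp hp1
    · intro ω ω' _ _ h
      simp only [Prod.mk.injEq] at h
      linear_combination h.1 + h.2
    · intro ω ω' _ _ h
      simp only [Prod.mk.injEq] at h
      simp only [h.1, h.2]
    · intro ω ω' h0 h0' h
      simp only [Prod.mk.injEq] at h ⊢
      obtain ⟨⟨h1, h2⟩, h3, h4⟩ := h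
      rw [h4] at h1 h2
      exact ⟨mul_right_cancel₀ (nD ω' h0') h1, mul_right_cancel₀ (nD ω' h0') h2, h4⟩
  have S2a := ent_subadd p hp hp1 (fun ω => A ω * D ω) (fun ω => C ω * D ω)
  have S2b := ent_subadd p hp hp1 (fun ω => A ω + C ω) D
  -- lower bound for the joint entropy
  have S3 : ent p (fun ω => A ω * B ω) + ent p (fun ω => (A ω, B ω, C ω, D ω)) ≤
      ent p (fun ω => (A ω * B ω, C ω * D ω, A ω * (B ω - D ω), (A ω + C ω) * D ω)) +
      ent p (fun ω => (A ω, B ω)) := by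
    apply ent_submod' p hp hp1
    · intro ω ω' _ _ h
      simp only [Prod.mk.injEq] at h
      exact h.1
    · intro ω ω' _ _ h
      simp only [Prod.mk.injEq] at h
      simp only [h.1, h.2]
    · intro ω ω' h0 h0' h
      simp only [Prod.mk.injEq] at h ⊢
      obtain ⟨⟨h1, h2, h3, h4⟩, h5, h6⟩ := h
      have hD' : D ω = D ω' := by
        refine mul_left_cancel₀ (nA ω' h0') ?_
        rw [h5, h6] at h3
        linear_combination -h3
      rw [hD'] at h2
      exact ⟨h5, h6, mul_right_cancel₀ (nD ω' h0') h2, hD'⟩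
  have S3a := ent_subadd p hp hp1 A B
  have S4 := ent_subadd p hp hp1 (fun ω => A ω * B ω) (fun ω => C ω * D ω)
  have S5 := ent_subadd p hp hp1 (fun ω => A ω * (B ω - D ω)) (fun ω => (A ω + C ω) * D ω)
  -- difference versus sum
  have S6 : ent p (fun ω => A ω - B ω) + ent p (fun ω => (A ω, B ω, C ω)) ≤
      ent p (fun ω => (A ω, B ω)) + ent p (fun ω => (A ω + C ω, B ω + C ω)) := by
    apply ent_submod' p hp hp1
    · intro ω ω' _ _ h
      simp only [Prod.mk.injEq] at h
      simp only [h.1, h.2]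
    · intro ω ω' _ _ h
      simp only [Prod.mk.injEq] at h
      linear_combination h.1 - h.2
    · intro ω ω' h0 h0' h
      simp only [Prod.mk.injEq] at h ⊢
      obtain ⟨⟨h1, h2⟩, h3, h4⟩ := h
      exact ⟨h1, h2, by linear_combination h3 - h1⟩
  have S6a := ent_subadd p hp hp1 (fun ω => A ω + C ω) (fun ω => B ω + C ω)
  constructor <;> linarith
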